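/- The functional J(Q) = ∫_Γ L(γ) dQ(γ) + ∫₀^T F(e_t#Q) dt + G(Q) is lower semi-continuous on P(Γ) for the narrow topology, and the minimization problem (M_{μ⁰}): inf { J(Q) : Q ∈ P(Γ), e₀#Q = μ⁰ } admits at least one minimizer. -/

import Mathlib

open MeasureTheory Filter Topology Set
open scoped ENNReal NNReal

noncomputable section

abbrev Euc (d : ℕ) : Type := EuclideanSpace ℝ (Fin d)

abbrev Traj (d : ℕ) (T : ℝ) : Type := C(Set.Icc (0:ℝ) T, Euc d)

instance (d : ℕ) (T : ℝ) : MeasurableSpace (Traj d T) := borel _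
instance (d : ℕ) (T : ℝ) : BorelSpace (Traj d T) := ⟨rfl⟩

/-- evaluation of a trajectory at time `t ∈ ℝ` (projected onto `[0,T]`). -/
def evalAt {d : ℕ} {T : ℝ} (hT : 0 ≤ T) (t : ℝ) (γ : Traj d T) : Euc d :=
  γ (Set.projIcc 0 T hT t)

/-- Narrow convergence of a sequence of measures. -/
def NarrowTendsto {X : Type*} [TopologicalSpace X] [MeasurableSpace X]
    (μ : ℕ → Measure X) (ν : Measure X) : Prop :=
  ∀ f : BoundedContinuousFunction X ℝ,
    Tendsto (fun n => ∫ x, f x ∂(μ n)) atTop (𝓝 (∫ x, f x ∂ν))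

/-- Squared 2-Wasserstein distance. -/
def W2sq {X : Type*} [MeasurableSpace X] [PseudoMetricSpace X]
    (μ ν : Measure X) : ℝ≥0∞ :=
  ⨅ (π : Measure (X × X)) (_ : π.map Prod.fst = μ ∧ π.map Prod.snd = ν),
    ∫⁻ p, ENNReal.ofReal (dist p.1 p.2 ^ 2) ∂π

/-- Uniform discrete probability measures on `N` points. -/
def IsUnifDiscrete {X : Type*} [MeasurableSpace X] (N : ℕ) (μ : Measure X) : Prop :=
  ∃ x : Fin N → X, μ = ((N : ℝ≥0∞))⁻¹ • ∑ i, MeasureTheory.Measure.dirac (x i)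

/-- Shifted (by `+C`) kinetic action: equals `∫₀ᵀ (L(γ'(t)) + C) dt` if `γ ∈ W^{1,r}`,
`+∞` otherwise. -/
def actionN {d : ℕ} {T : ℝ} (L : Euc d → ℝ) (C : ℝ) (γ : Traj d T) : ℝ≥0∞ :=
  sInf { a : ℝ≥0∞ | ∃ g : ℝ → Euc d, IntervalIntegrable g volume 0 T ∧
      (∀ s t : Set.Icc (0:ℝ) T, γ t - γ s = ∫ u in (s:ℝ)..(t:ℝ), g u) ∧
      a = ∫⁻ t in Set.Ioc (0:ℝ) T, ENNReal.ofReal (L (g t) + C) }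

/-- Kinetic part of the energy: `∫_Γ L(γ) dQ(γ)`. -/
def kinE {d : ℕ} {T : ℝ} (L : Euc d → ℝ) (C : ℝ) (Q : Measure (Traj d T)) : EReal :=
  ((∫⁻ γ, actionN L C γ ∂Q : ℝ≥0∞) : EReal) - ((C * T : ℝ) : EReal)

/-- The mean-field game energy `J`. -/
def Jfun {d : ℕ} {T : ℝ} (hT : 0 ≤ T) (L : Euc d → ℝ) (C : ℝ)
    (F : Measure (Euc d) → ℝ≥0∞) (G : Measure (Traj d T) → ℝ)
    (Q : Measure (Traj d T)) : EReal :=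
  kinE L C Q
    + ((∫⁻ t in Set.Ioc (0:ℝ) T, F (Q.map (evalAt hT t)) : ℝ≥0∞) : EReal)
    + ((G Q : ℝ) : EReal)

/-- Moreau envelope of `F` with parameter `ε` in the 2-Wasserstein space. -/
def moreau {d : ℕ} (Ω : Set (Euc d)) (F : Measure (Euc d) → ℝ≥0∞) (ε : ℝ)
    (μ : Measure (Euc d)) : ℝ≥0∞ :=
  ⨅ (ρ : Measure (Euc d)) (_ : IsProbabilityMeasure ρ ∧ ρ Ωᶜ = 0),
    W2sq μ ρ / ENNReal.ofReal (2 * ε) + F ρ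

/-- The regularized energy `J_ε`. -/
def Jeps {d : ℕ} {T : ℝ} (hT : 0 ≤ T) (Ω : Set (Euc d)) (L : Euc d → ℝ) (C : ℝ)
    (F : Measure (Euc d) → ℝ≥0∞) (G : Measure (Traj d T) → ℝ) (ε : ℝ)
    (Q : Measure (Traj d T)) : EReal :=
  kinE L C Q
    + ((∫⁻ t in Set.Ioc (0:ℝ) T, moreau Ω F ε (Q.map (evalAt hT t)) : ℝ≥0∞) : EReal)
    + ((G Q : ℝ) : EReal)

end


noncomputable section LscAux

/-- Discrete energy of one cell. -/
def cellE {d : ℕ} (L : Euc d → ℝ) (C : ℝ) (φ : ℝ → Euc d) (a b : ℝ) : ℝ≥0∞ :=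
  ENNReal.ofReal (b - a) * ENNReal.ofReal (L ((b - a)⁻¹ • (φ b - φ a)) + C)

/-- Discrete energy of a finite family of cells. -/
def partE {d : ℕ} {T : ℝ} (hT : 0 ≤ T) (L : Euc d → ℝ) (C : ℝ) (E : ℕ × (ℕ → ℝ × ℝ))
    (γ : Traj d T) : ℝ≥0∞ :=
  ∑ i ∈ Finset.range E.1, cellE L C (fun t => evalAt hT t γ) (E.2 i).1 (E.2 i).2

/-- Admissible families of cells. -/
def goodP (T : ℝ) : Set (ℕ × (ℕ → ℝ × ℝ)) :=
  {E | (∀ i < E.1, 0 ≤ (E.2 i).1 ∧ (E.2 i).1 ≤ (E.2 i).2 ∧ (E.2 i).2 ≤ T) ∧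
    Set.PairwiseDisjoint (Finset.range E.1 : Set ℕ) (fun i => Ioc (E.2 i).1 (E.2 i).2)}

theorem aux_continuous_evalAt {d : ℕ} {T : ℝ} (hT : 0 ≤ T) (t : ℝ) :
    Continuous (evalAt (d := d) hT t) := by
  unfold evalAt
  exact continuous_eval_const _

theorem aux_continuous_evalAt_time {d : ℕ} {T : ℝ} (hT : 0 ≤ T) (γ : Traj d T) :
    Continuous (fun t => evalAt hT t γ) := by
  unfold evalAt
  exact γ.continuous.comp continuous_projIcc

theorem aux_continuous_partE {d : ℕ} {T : ℝ} (hT : 0 ≤ T) (L : Euc d → ℝ) (C : ℝ)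
    (hL : Continuous L) (E : ℕ × (ℕ → ℝ × ℝ)) :
    Continuous (partE (d := d) hT L C E) := by
  unfold partE cellE
  refine continuous_finsetSum _ (fun i _ => ?_)
  refine (ENNReal.continuous_const_mul ENNReal.ofReal_ne_top).comp ?_
  refine ENNReal.continuous_ofReal.comp ?_
  have h1 := aux_continuous_evalAt (d := d) hT (E.2 i).1
  have h2 := aux_continuous_evalAt (d := d) hT (E.2 i).2
  fun_prop

theorem aux_cell_le {d : ℕ} {T : ℝ} (L : Euc d → ℝ) (C : ℝ)
    (hLconv : ConvexOn ℝ Set.univ L) (hLcont : Continuous L) (hLC : ∀ p, 0 ≤ L p + C)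
    (g : ℝ → Euc d) (hg : IntervalIntegrable g volume 0 T) (φ : ℝ → Euc d)
    (a b : ℝ) (ha : 0 ≤ a) (hab : a ≤ b) (hb : b ≤ T)
    (hφ : φ b - φ a = ∫ u in a..b, g u) :
    cellE L C φ a b ≤ ∫⁻ t in Ioc a b, ENNReal.ofReal (L (g t) + C) := by
  rcases hab.eq_or_lt with rfl | hlt
  · simp [cellE]
  have hT : 0 ≤ T := ha.trans (hab.trans hb)
  by_cases htop : ∫⁻ t in Ioc a b, ENNReal.ofReal (L (g t) + C) = ⊤
  · rw [htop]; exact le_top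
  have hgi : IntegrableOn g (Ioc a b) volume := by
    rw [intervalIntegrable_iff_integrableOn_Ioc_of_le hT] at hg
    exact hg.mono_set (Ioc_subset_Ioc ha hb)
  have hmeas : AEStronglyMeasurable (fun t => L (g t) + C) (volume.restrict (Ioc a b)) :=
    (hLcont.comp_aestronglyMeasurable hgi.1).add aestronglyMeasurable_const
  have hInteg : Integrable (fun t => L (g t) + C) (volume.restrict (Ioc a b)) := by
    refine ⟨hmeas, ?_⟩
    rw [hasFiniteIntegral_iff_ofReal (Eventually.of_forall fun t => hLC _)]
    exact lt_top_iff_ne_top.2 htop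
  have hconv : ConvexOn ℝ Set.univ (fun p => L p + C) := hLconv.add_const C
  have hJ := hconv.map_set_average_le (μ := volume) (t := Ioc a b) (f := g)
    ((hLcont.add continuous_const).continuousOn) isClosed_univ
    (by simp [hlt]) (by simp) (by simp) hgi hInteg
  rw [setAverage_eq, setAverage_eq] at hJ
  have hvol : volume.real (Ioc a b) = b - a := by simp [hab]
  rw [hvol, ← intervalIntegral.integral_of_le hab, ← hφ] at hJ
  have hpos : 0 < b - a := sub_pos.2 hlt
  unfold cellE
  rw [← ENNReal.ofReal_mul hpos.le,
    ← ofReal_integral_eq_lintegral_ofReal hInteg (Eventually.of_forall fun t => hLC _)]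
  apply ENNReal.ofReal_le_ofReal
  rw [smul_eq_mul] at hJ
  have := mul_le_mul_of_nonneg_left hJ hpos.le
  rwa [mul_inv_cancel_left₀ hpos.ne'] at this

theorem aux_partE_le {d : ℕ} {T : ℝ} (hT : 0 ≤ T) (L : Euc d → ℝ) (C : ℝ)
    (hLconv : ConvexOn ℝ Set.univ L) (hLcont : Continuous L) (hLC : ∀ p, 0 ≤ L p + C)
    (E : ℕ × (ℕ → ℝ × ℝ)) (hE : E ∈ goodP T) (γ : Traj d T) :
    partE hT L C E γ ≤ actionN L C γ := by
  refine le_sInf ?_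
  rintro a ⟨g, hg, hγ, rfl⟩
  obtain ⟨h1, h2⟩ := hE
  calc partE hT L C E γ
      ≤ ∑ i ∈ Finset.range E.1,
          ∫⁻ t in Ioc (E.2 i).1 (E.2 i).2, ENNReal.ofReal (L (g t) + C) := by
        refine Finset.sum_le_sum (fun i hi => ?_)
        obtain ⟨k1, k2, k3⟩ := h1 i (Finset.mem_range.1 hi)
        refine aux_cell_le (T := T) L C hLconv hLcont hLC g hg _ _ _ k1 k2 k3 ?_
        have := hγ ⟨(E.2 i).1, k1, k2.trans k3⟩ ⟨(E.2 i).2, k1.trans k2, k3⟩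
        simp only [evalAt]
        rw [projIcc_of_mem hT ⟨k1, k2.trans k3⟩, projIcc_of_mem hT ⟨k1.trans k2, k3⟩]
        exact this
    _ = ∫⁻ t in ⋃ i ∈ Finset.range E.1, Ioc (E.2 i).1 (E.2 i).2,
          ENNReal.ofReal (L (g t) + C) := by
        rw [lintegral_biUnion_finset h2 (fun _ _ => measurableSet_Ioc)]
    _ ≤ _ := by
        refine lintegral_mono_set ?_
        refine iUnion₂_subset (fun i hi => ?_)
        obtain ⟨k1, k2, k3⟩ := h1 i (Finset.mem_range.1 hi)
        exact Ioc_subset_Ioc k1 k3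

theorem aux_norm_le {d : ℕ} (r C : ℝ) (hr : 1 < r) (hC : 0 < C) (L : Euc d → ℝ)
    (hLgrow : ∀ p : Euc d, 1 / (r * C) * ‖p‖ ^ r - C ≤ L p ∧ L p ≤ C / r * ‖p‖ ^ r + C)
    (l : ℝ) (hl : 0 < l) (p : Euc d) :
    ‖p‖ ≤ l + l ^ (1 - r) * (r * C) * (L p + C) := by
  have hrC : 0 < r * C := by positivity
  have h1 : ‖p‖ ^ r ≤ (r * C) * (L p + C) := by
    have := (hLgrow p).1
    have h : 1 / (r * C) * ‖p‖ ^ r ≤ L p + C := by linarith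
    rw [one_div, inv_mul_le_iff₀ hrC] at h
    exact h
  have h0 : 0 ≤ ‖p‖ ^ r := by positivity
  have hl' : 0 < l ^ (1 - r) := by positivity
  have h2 : l ^ (1 - r) * ‖p‖ ^ r ≤ l ^ (1 - r) * (r * C) * (L p + C) := by
    rw [mul_assoc]; exact mul_le_mul_of_nonneg_left h1 hl'.le
  rcases le_or_gt ‖p‖ l with h | h
  · have : 0 ≤ l ^ (1 - r) * ‖p‖ ^ r := by positivity
    linarith
  · have hp : 0 < ‖p‖ := hl.trans h
    have h3 : ‖p‖ ^ (1 - r) ≤ l ^ (1 - r) :=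
      Real.rpow_le_rpow_of_nonpos hl h.le (by linarith)
    have h4 : ‖p‖ = ‖p‖ ^ (1 - r) * ‖p‖ ^ r := by
      rw [← Real.rpow_add hp]; simp
    have h5 := mul_le_mul_of_nonneg_right h3 h0
    linarith

theorem aux_dist_le {d : ℕ} (r C : ℝ) (hr : 1 < r) (hC : 0 < C) (L : Euc d → ℝ)
    (hLgrow : ∀ p : Euc d, 1 / (r * C) * ‖p‖ ^ r - C ≤ L p ∧ L p ≤ C / r * ‖p‖ ^ r + C)
    (hLC : ∀ p, 0 ≤ L p + C)
    (l : ℝ) (hl : 0 < l) (φ : ℝ → Euc d) (a b : ℝ) (hab : a ≤ b) :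
    ‖φ b - φ a‖ ≤ l * (b - a) + l ^ (1 - r) * (r * C) * (cellE L C φ a b).toReal := by
  rcases hab.eq_or_lt with rfl | hlt
  · simp [cellE]
  have hpos : 0 < b - a := sub_pos.2 hlt
  have := aux_norm_le r C hr hC L hLgrow l hl ((b - a)⁻¹ • (φ b - φ a))
  rw [norm_smul, Real.norm_of_nonneg (inv_nonneg.2 hpos.le), inv_mul_le_iff₀ hpos] at this
  have h2 : (cellE L C φ a b).toReal = (b - a) * (L ((b - a)⁻¹ • (φ b - φ a)) + C) := by
    unfold cellE
    rw [← ENNReal.ofReal_mul hpos.le, ENNReal.toReal_ofReal (mul_nonneg hpos.le (hLC _))]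
  rw [h2]
  linarith

theorem aux_sum_dist_le {d : ℕ} {T : ℝ} (hT : 0 ≤ T) (r C : ℝ) (hr : 1 < r) (hC : 0 < C)
    (L : Euc d → ℝ)
    (hLgrow : ∀ p : Euc d, 1 / (r * C) * ‖p‖ ^ r - C ≤ L p ∧ L p ≤ C / r * ‖p‖ ^ r + C)
    (hLC : ∀ p, 0 ≤ L p + C)
    (l : ℝ) (hl : 0 < l) (γ : Traj d T) (E : ℕ × (ℕ → ℝ × ℝ)) (hE : E ∈ goodP T)
    (R : ℝ) (hR : 0 ≤ R) (h : partE hT L C E γ ≤ ENNReal.ofReal R) :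
    ∑ i ∈ Finset.range E.1, ‖evalAt hT (E.2 i).2 γ - evalAt hT (E.2 i).1 γ‖
      ≤ l * ∑ i ∈ Finset.range E.1, ((E.2 i).2 - (E.2 i).1) + l ^ (1 - r) * (r * C) * R := by
  have hrC : 0 < r * C := by positivity
  have hl' : 0 < l ^ (1 - r) := by positivity
  have h1 : ∑ i ∈ Finset.range E.1,
      (cellE L C (fun t => evalAt hT t γ) (E.2 i).1 (E.2 i).2).toReal ≤ R := by
    rw [← ENNReal.toReal_sum]
    · exact ENNReal.toReal_le_of_le_ofReal hR h
    · intro i _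
      exact ENNReal.mul_ne_top ENNReal.ofReal_ne_top ENNReal.ofReal_ne_top
  calc _ ≤ ∑ i ∈ Finset.range E.1, (l * ((E.2 i).2 - (E.2 i).1) + l ^ (1 - r) * (r * C) *
        (cellE L C (fun t => evalAt hT t γ) (E.2 i).1 (E.2 i).2).toReal) :=
        Finset.sum_le_sum (fun i hi => aux_dist_le r C hr hC L hLgrow hLC l hl
          (fun t => evalAt hT t γ) _ _ (hE.1 i (Finset.mem_range.1 hi)).2.1)
    _ = l * ∑ i ∈ Finset.range E.1, ((E.2 i).2 - (E.2 i).1) + l ^ (1 - r) * (r * C) *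
        ∑ i ∈ Finset.range E.1,
          (cellE L C (fun t => evalAt hT t γ) (E.2 i).1 (E.2 i).2).toReal := by
        rw [Finset.sum_add_distrib, Finset.mul_sum, Finset.mul_sum]
    _ ≤ _ := by gcongr

/-- For every `ε` there are `l, δ` making the modulus small. -/
theorem aux_modulus (r C R ε : ℝ) (hr : 1 < r) (hε : 0 < ε) :
    ∃ l > 0, ∃ δ > 0, l * δ + l ^ (1 - r) * (r * C) * R < ε := by
  have h1 : Tendsto (fun l : ℝ => l ^ (1 - r) * (r * C) * R) atTop (𝓝 0) := by
    have := tendsto_rpow_neg_atTop (y := r - 1) (by linarith)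
    have h := (this.mul_const (r * C)).mul_const R
    simpa using h
  have h2 := (h1.eventually (gt_mem_nhds (half_pos hε))).and (eventually_gt_atTop 0)
  obtain ⟨l, hl1, hl2⟩ := h2.exists
  refine ⟨l, hl2, ε / 2 / l, by positivity, ?_⟩
  rw [mul_div_cancel₀ _ hl2.ne']
  linarith

theorem aux_ac {d : ℕ} {T : ℝ} (hT : 0 ≤ T) (r C : ℝ) (hr : 1 < r) (hC : 0 < C)
    (L : Euc d → ℝ)
    (hLgrow : ∀ p : Euc d, 1 / (r * C) * ‖p‖ ^ r - C ≤ L p ∧ L p ≤ C / r * ‖p‖ ^ r + C)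
    (hLC : ∀ p, 0 ≤ L p + C) (γ : Traj d T) (R : ℝ) (hR : 0 ≤ R)
    (h : ∀ E ∈ goodP T, partE hT L C E γ ≤ ENNReal.ofReal R) (j : Fin d) :
    AbsolutelyContinuousOnInterval (fun t => evalAt hT t γ j) 0 T := by
  rw [absolutelyContinuousOnInterval_iff]
  intro ε hε
  obtain ⟨l, hl, δ, hδ, hlt⟩ := aux_modulus r C R ε hr hε
  refine ⟨δ, hδ, fun E hE hlen => ?_⟩
  let E' : ℕ × (ℕ → ℝ × ℝ) :=
    (E.1, fun i => (min (E.2 i).1 (E.2 i).2, max (E.2 i).1 (E.2 i).2))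
  have hE' : E' ∈ goodP T := by
    obtain ⟨k1, k2⟩ := hE
    refine ⟨fun i hi => ?_, k2⟩
    have := k1 i (Finset.mem_range.2 hi)
    rw [uIcc_of_le hT] at this
    exact ⟨le_min this.1.1 this.2.1, min_le_max, max_le this.1.2 this.2.2⟩
  have key := aux_sum_dist_le hT r C hr hC L hLgrow hLC l hl γ E' hE' R hR (h E' hE')
  have e1 : ∑ i ∈ Finset.range E'.1, ((E'.2 i).2 - (E'.2 i).1)
      = ∑ i ∈ Finset.range E.1, dist (E.2 i).1 (E.2 i).2 := by
    refine Finset.sum_congr rfl (fun i _ => ?_)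
    simp only [E', Real.dist_eq]
    exact max_sub_min_eq_abs' _ _
  have e2 : ∑ i ∈ Finset.range E.1, dist (evalAt hT (E.2 i).1 γ j) (evalAt hT (E.2 i).2 γ j)
      ≤ ∑ i ∈ Finset.range E'.1, ‖evalAt hT (E'.2 i).2 γ - evalAt hT (E'.2 i).1 γ‖ := by
    refine Finset.sum_le_sum (fun i _ => ?_)
    have h0 : ∀ x y : Euc d, dist (x j) (y j) ≤ ‖y - x‖ := by
      intro x y
      rw [dist_comm, dist_eq_norm]
      exact PiLp.norm_apply_le (y - x) j
    simp only [E']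
    rcases le_total (E.2 i).1 (E.2 i).2 with hh | hh
    · rw [min_eq_left hh, max_eq_right hh]; exact h0 _ _
    · rw [min_eq_right hh, max_eq_left hh, dist_comm]; exact h0 _ _
  rw [e1] at key
  have : l * ∑ i ∈ Finset.range E.1, dist (E.2 i).1 (E.2 i).2 ≤ l * δ := by gcongr
  linarith

/-- Straddle lemma. -/
theorem aux_straddle (f : ℝ → ℝ) (f' t : ℝ) (hf : HasDerivAt f f' t) (a b : ℕ → ℝ)
    (hat : ∀ n, a n ≤ t) (htb : ∀ n, t ≤ b n) (hab : ∀ n, a n < b n)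
    (ha : Tendsto a atTop (𝓝 t)) (hb : Tendsto b atTop (𝓝 t)) :
    Tendsto (fun n => (b n - a n)⁻¹ * (f (b n) - f (a n))) atTop (𝓝 f') := by
  rw [Metric.tendsto_atTop']
  intro ε hε
  have h := (hasDerivAt_iff_isLittleO.1 hf).def (half_pos hε)
  obtain ⟨N, hN⟩ := ((ha.eventually h).and (hb.eventually h)).exists_forall_of_atTop
  refine ⟨N, fun n hn => ?_⟩
  obtain ⟨h1, h2⟩ := hN n hn.le
  have hpos : 0 < b n - a n := sub_pos.2 (hab n)
  rw [Real.norm_eq_abs, Real.norm_eq_abs, smul_eq_mul] at h1 h2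
  rw [abs_of_nonpos (sub_nonpos.2 (hat n))] at h1
  rw [abs_of_nonneg (sub_nonneg.2 (htb n))] at h2
  rw [Real.dist_eq]
  have e : (b n - a n)⁻¹ * (f (b n) - f (a n)) - f'
      = (b n - a n)⁻¹ * ((f (b n) - f t - (b n - t) * f') - (f (a n) - f t - (a n - t) * f')) := by
    field_simp; ring
  rw [e, abs_mul, abs_of_pos (inv_pos.2 hpos), inv_mul_lt_iff₀ hpos]
  have := abs_sub (f (b n) - f t - (b n - t) * f') (f (a n) - f t - (a n - t) * f')
  nlinarith

theorem aux_ceil (h : ℝ) (hh : 0 < h) (i : ℕ) (t : ℝ) :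
    ⌈t / h⌉₊ = i + 1 ↔ t ∈ Ioc ((i : ℝ) * h) (((i : ℝ) + 1) * h) := by
  rw [Nat.ceil_eq_iff (Nat.succ_ne_zero i), mem_Ioc, div_le_iff₀ hh, lt_div_iff₀ hh]
  simp

/-- The uniform grid. -/
def gridE (T : ℝ) (n : ℕ) : ℕ × (ℕ → ℝ × ℝ) :=
  (n + 1, fun i => ((i : ℝ) * (T / (n + 1)), ((i : ℝ) + 1) * (T / (n + 1))))

theorem aux_grid_disj (T : ℝ) (hT : 0 < T) (n : ℕ) :
    Set.PairwiseDisjoint (Finset.range (gridE T n).1 : Set ℕ)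
      (fun i => Ioc ((gridE T n).2 i).1 ((gridE T n).2 i).2) := by
  have hh : 0 < T / ((n : ℝ) + 1) := by positivity
  intro i _ j _ hij
  refine Set.disjoint_left.2 (fun t hi hj => hij ?_)
  have h1 := (aux_ceil _ hh i t).2 hi
  have h2 := (aux_ceil _ hh j t).2 hj
  omega

theorem aux_grid_good (T : ℝ) (hT : 0 < T) (n : ℕ) : gridE T n ∈ goodP T := by
  have hh : 0 < T / ((n : ℝ) + 1) := by positivity
  refine ⟨fun i hi => ⟨?_, ?_, ?_⟩, aux_grid_disj T hT n⟩
  · simp only [gridE]; positivity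
  · simp only [gridE]; nlinarith
  · simp only [gridE] at hi ⊢
    have : ((i : ℝ) + 1) ≤ n + 1 := by exact_mod_cast hi
    calc ((i : ℝ) + 1) * (T / (n + 1)) ≤ (n + 1) * (T / (n + 1)) := by gcongr
      _ = T := by field_simp

/-- Difference quotient on the grid. -/
def gridG {d : ℕ} (T : ℝ) (φ : ℝ → Euc d) (n : ℕ) (t : ℝ) : Euc d :=
  (fun m : ℕ => ((m : ℝ) * (T / (n + 1)) - ((m : ℝ) - 1) * (T / (n + 1)))⁻¹ •
    (φ ((m : ℝ) * (T / (n + 1))) - φ (((m : ℝ) - 1) * (T / (n + 1)))))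
    ⌈t / (T / (n + 1))⌉₊

theorem aux_gridG_meas {d : ℕ} (T : ℝ) (φ : ℝ → Euc d) (n : ℕ) :
    Measurable (gridG T φ n) := by
  have h : Measurable (fun t : ℝ => ⌈t / (T / ((n : ℝ) + 1))⌉₊) :=
    Nat.measurable_ceil.comp ((measurable_id (α := ℝ)).div_const _)
  have h2 : Measurable (fun m : ℕ => ((m : ℝ) * (T / (n + 1)) - ((m : ℝ) - 1) * (T / (n + 1)))⁻¹ •
      (φ ((m : ℝ) * (T / (n + 1))) - φ (((m : ℝ) - 1) * (T / (n + 1))))) := measurable_from_top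
  exact h2.comp h

theorem aux_grid_lintegral {d : ℕ} {T : ℝ} (hT : 0 < T) (L : Euc d → ℝ) (C : ℝ)
    (γ : Traj d T) (n : ℕ) :
    ∫⁻ t in Ioc 0 T, ENNReal.ofReal (L (gridG T (fun t => evalAt hT.le t γ) n t) + C)
      ≤ partE hT.le L C (gridE T n) γ := by
  have hh : 0 < T / ((n : ℝ) + 1) := by positivity
  set φ : ℝ → Euc d := fun t => evalAt hT.le t γ with hφ
  calc _ ≤ ∫⁻ t in ⋃ i ∈ Finset.range (gridE T n).1,
          Ioc ((gridE T n).2 i).1 ((gridE T n).2 i).2,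
          ENNReal.ofReal (L (gridG T φ n t) + C) := by
        refine lintegral_mono_set (fun t ht => ?_)
        obtain ⟨i, hi⟩ : ∃ i, ⌈t / (T / ((n : ℝ) + 1))⌉₊ = i + 1 :=
          Nat.exists_eq_succ_of_ne_zero (Nat.ceil_pos.2 (div_pos ht.1 hh)).ne'
        have hm := (aux_ceil _ hh i t).1 hi
        refine mem_iUnion₂.2 ⟨i, ?_, hm⟩
        rw [Finset.mem_range]
        show i < n + 1
        have h1 : ⌈t / (T / ((n : ℝ) + 1))⌉₊ ≤ n + 1 := by
          rw [Nat.ceil_le, div_le_iff₀ hh]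
          push_cast
          rw [mul_div_cancel₀ _ (by positivity)]
          exact ht.2
        omega
    _ = ∑ i ∈ Finset.range (gridE T n).1,
          ∫⁻ t in Ioc ((gridE T n).2 i).1 ((gridE T n).2 i).2,
          ENNReal.ofReal (L (gridG T φ n t) + C) :=
        lintegral_biUnion_finset (aux_grid_disj T hT n) (fun _ _ => measurableSet_Ioc) _
    _ = partE hT.le L C (gridE T n) γ := by
        refine Finset.sum_congr rfl (fun i _ => ?_)
        rw [setLIntegral_congr_fun (g := fun _ => ENNReal.ofReal
          (L ((((i : ℝ) + 1) * (T / (n + 1)) - (i : ℝ) * (T / (n + 1)))⁻¹ •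
            (φ (((i : ℝ) + 1) * (T / (n + 1))) - φ ((i : ℝ) * (T / (n + 1))))) + C))
          measurableSet_Ioc]
        · rw [setLIntegral_const, mul_comm]
          simp only [cellE, gridE, Real.volume_Ioc, hφ]
        · intro t ht
          have := (aux_ceil _ hh i t).2 ht
          simp only [gridG, this]
          push_cast
          simp only [add_sub_cancel_right]

theorem aux_gridG_tendsto {d : ℕ} {T : ℝ} (hT : 0 < T) (φ : ℝ → Euc d) (t : ℝ) (ht : t ∈ Ioc 0 T)
    (g : Euc d) (hφ : ∀ j, HasDerivAt (fun s => φ s j) (g j) t) :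
    Tendsto (fun n => gridG T φ n t) atTop (𝓝 g) := by
  have hh : ∀ n : ℕ, 0 < T / ((n : ℝ) + 1) := fun n => by positivity
  have hlim : Tendsto (fun n : ℕ => T / ((n : ℝ) + 1)) atTop (𝓝 0) := by
    have := (tendsto_one_div_add_atTop_nhds_zero_nat (𝕜 := ℝ)).const_mul T
    simpa [div_eq_mul_inv] using this
  have k1 : ∀ n : ℕ, ((⌈t / (T / ((n : ℝ) + 1))⌉₊ : ℝ) - 1) * (T / (n + 1)) ≤ t := fun n => by
    rw [← le_div_iff₀ (hh n)]
    have := Nat.ceil_lt_add_one (div_pos ht.1 (hh n)).le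
    linarith
  have k2 : ∀ n : ℕ, t ≤ (⌈t / (T / ((n : ℝ) + 1))⌉₊ : ℝ) * (T / (n + 1)) := fun n => by
    rw [← div_le_iff₀ (hh n)]
    exact Nat.le_ceil _
  have l1 : Tendsto (fun n : ℕ => ((⌈t / (T / ((n : ℝ) + 1))⌉₊ : ℝ) - 1) * (T / (n + 1)))
      atTop (𝓝 t) := by
    refine tendsto_of_tendsto_of_tendsto_of_le_of_le (g := fun n : ℕ => t - T / ((n : ℝ) + 1))
      (by simpa using hlim.const_sub t) tendsto_const_nhds (fun n => ?_) k1
    have := k2 n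
    simp only
    linarith
  have l2 : Tendsto (fun n : ℕ => (⌈t / (T / ((n : ℝ) + 1))⌉₊ : ℝ) * (T / (n + 1)))
      atTop (𝓝 t) := by
    have := l1.add hlim
    rw [add_zero] at this
    refine this.congr (fun n => by ring)
  have hc : Tendsto (fun n => WithLp.ofLp (gridG T φ n t)) atTop (𝓝 (WithLp.ofLp g)) := by
    rw [tendsto_pi_nhds]
    intro j
    have := aux_straddle _ _ _ (hφ j) _ _ k1 k2 (fun n => by have := hh n; linarith) l1 l2
    simpa [gridG] using this
  exact ((PiLp.continuous_toLp 2 _).tendsto _).comp hc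

theorem aux_action_le {d : ℕ} {T : ℝ} (hT : 0 < T) (r C : ℝ) (hr : 1 < r) (hC : 0 < C)
    (L : Euc d → ℝ) (hLcont : Continuous L)
    (hLgrow : ∀ p : Euc d, 1 / (r * C) * ‖p‖ ^ r - C ≤ L p ∧ L p ≤ C / r * ‖p‖ ^ r + C)
    (hLC : ∀ p, 0 ≤ L p + C) (γ : Traj d T) (R : ℝ) (hR : 0 ≤ R)
    (h : ∀ E ∈ goodP T, partE hT.le L C E γ ≤ ENNReal.ofReal R) :
    actionN L C γ ≤ ENNReal.ofReal R := by
  set φ : ℝ → Euc d := fun t => evalAt hT.le t γ with hφ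
  have hac : ∀ j, AbsolutelyContinuousOnInterval (fun t => φ t j) 0 T :=
    aux_ac hT.le r C hr hC L hLgrow hLC γ R hR h
  let g : ℝ → Euc d := fun t => WithLp.toLp 2 (fun j => deriv (fun s => φ s j) t)
  have hgj : ∀ j, IntervalIntegrable (fun t => g t j) volume 0 T :=
    fun j => (hac j).intervalIntegrable_deriv
  have hg : IntervalIntegrable g volume 0 T := by
    rw [intervalIntegrable_iff]
    refine Integrable.of_eval_piLp (fun j => ?_)
    exact intervalIntegrable_iff.1 (hgj j)
  have hgφ : ∀ s t : Set.Icc (0:ℝ) T, γ t - γ s = ∫ u in (s:ℝ)..(t:ℝ), g u := by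
    intro s t
    have hsub : uIcc (s:ℝ) t ⊆ uIcc 0 T := by
      rw [uIcc_of_le hT.le]
      exact uIcc_subset_Icc s.2 t.2
    have hgst : IntervalIntegrable g volume s t := hg.mono_set hsub
    ext j
    have h1 := (EuclideanSpace.proj (𝕜 := ℝ) j).intervalIntegral_comp_comm hgst
    have h2 := ((hac j).mono hsub).integral_deriv_eq_sub
    have e : ∀ u : Icc (0:ℝ) T, φ u = γ u := fun u => by
      simp [hφ, evalAt]
    rw [e, e] at h2
    have h3 : (∫ u in (s:ℝ)..(t:ℝ), g u) j = ∫ u in (s:ℝ)..(t:ℝ), g u j := by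
      simpa using h1.symm
    rw [h3]
    simpa [g] using h2.symm
  refine (sInf_le ⟨g, hg, hgφ, rfl⟩ : actionN L C γ ≤ _).trans ?_
  have hae : ∀ᵐ t ∂(volume.restrict (Ioc 0 T)), ∀ j, HasDerivAt (fun s => φ s j) (g t j) t := by
    rw [ae_all_iff]
    intro j
    rw [ae_restrict_iff' measurableSet_Ioc]
    filter_upwards [(hac j).ae_differentiableAt] with t ht htI
    rw [uIcc_of_le hT.le] at ht
    exact (ht ⟨htI.1.le, htI.2⟩).hasDerivAt
  calc ∫⁻ t in Ioc 0 T, ENNReal.ofReal (L (g t) + C)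
      ≤ ∫⁻ t in Ioc 0 T, liminf (fun n => ENNReal.ofReal (L (gridG T φ n t) + C)) atTop := by
        refine lintegral_mono_ae ?_
        filter_upwards [hae, ae_restrict_mem measurableSet_Ioc] with t ht htI
        have h1 := aux_gridG_tendsto hT φ t htI (g t) ht
        have h2 : Continuous (fun p : Euc d => ENNReal.ofReal (L p + C)) :=
          ENNReal.continuous_ofReal.comp (hLcont.add continuous_const)
        exact ((h2.tendsto _).comp h1).liminf_eq.ge
    _ ≤ liminf (fun n => ∫⁻ t in Ioc 0 T, ENNReal.ofReal (L (gridG T φ n t) + C)) atTop := by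
        refine lintegral_liminf_le (fun n => ?_)
        exact ENNReal.measurable_ofReal.comp
          ((hLcont.measurable.comp (aux_gridG_meas T φ n)).add_const C)
    _ ≤ ENNReal.ofReal R := by
        refine liminf_le_of_frequently_le' (Frequently.of_forall fun n => ?_)
        exact (aux_grid_lintegral hT L C γ n).trans (h _ (aux_grid_good T hT n))

theorem aux_action_eq {d : ℕ} {T : ℝ} (hT : 0 < T) (r C : ℝ) (hr : 1 < r) (hC : 0 < C)
    (L : Euc d → ℝ) (hLconv : ConvexOn ℝ Set.univ L) (hLcont : Continuous L)
    (hLgrow : ∀ p : Euc d, 1 / (r * C) * ‖p‖ ^ r - C ≤ L p ∧ L p ≤ C / r * ‖p‖ ^ r + C)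
    (hLC : ∀ p, 0 ≤ L p + C) (γ : Traj d T) :
    actionN L C γ = ⨆ E ∈ goodP T, partE hT.le L C E γ := by
  apply le_antisymm
  · set S := ⨆ E ∈ goodP T, partE hT.le L C E γ with hS
    by_cases htop : S = ⊤
    · rw [htop]; exact le_top
    · rw [← ENNReal.ofReal_toReal htop]
      refine aux_action_le hT r C hr hC L hLcont hLgrow hLC γ _ ENNReal.toReal_nonneg ?_
      intro E hE
      rw [ENNReal.ofReal_toReal htop]
      exact le_iSup₂ (f := fun E (_ : E ∈ goodP T) => partE hT.le L C E γ) E hE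
  · exact iSup₂_le (fun E hE => aux_partE_le hT.le L C hLconv hLcont hLC E hE γ)

theorem aux_action_lsc {d : ℕ} {T : ℝ} (hT : 0 < T) (r C : ℝ) (hr : 1 < r) (hC : 0 < C)
    (L : Euc d → ℝ) (hLconv : ConvexOn ℝ Set.univ L) (hLcont : Continuous L)
    (hLgrow : ∀ p : Euc d, 1 / (r * C) * ‖p‖ ^ r - C ≤ L p ∧ L p ≤ C / r * ‖p‖ ^ r + C)
    (hLC : ∀ p, 0 ≤ L p + C) :
    LowerSemicontinuous (actionN (d := d) (T := T) L C) := by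
  have : actionN (d := d) (T := T) L C = fun γ => ⨆ E ∈ goodP T, partE hT.le L C E γ :=
    funext (aux_action_eq hT r C hr hC L hLconv hLcont hLgrow hLC)
  rw [this]
  exact lowerSemicontinuous_biSup
    (fun E _ => (aux_continuous_partE hT.le L C hLcont E).lowerSemicontinuous)

theorem aux_lintegral_lsc {X : Type*} [TopologicalSpace X] [MeasurableSpace X] [BorelSpace X]
    {μ : Measure X} {μs : ℕ → Measure X} (f : X → ℝ≥0∞) (hf : LowerSemicontinuous f)
    (h_opens : ∀ G, IsOpen G → μ G ≤ atTop.liminf (fun i => μs i G)) :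
    ∫⁻ x, f x ∂μ ≤ atTop.liminf (fun i => ∫⁻ x, f x ∂(μs i)) := by
  have hfm : Measurable f := hf.measurable
  have hmin : ∀ n : ℕ, ∀ x, min (f x) n ≠ ⊤ := fun n x =>
    ne_top_of_le_ne_top (ENNReal.natCast_ne_top n) (min_le_right _ _)
  have hm : ∀ n : ℕ, Measurable (fun x => (min (f x) n).toReal) := fun n =>
    (hfm.min measurable_const).ennreal_toReal
  have key : ∀ n : ℕ, ∫⁻ x, min (f x) n ∂μ ≤ atTop.liminf (fun i => ∫⁻ x, f x ∂(μs i)) := by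
    intro n
    have hrep : ∀ ν : Measure X, ∫⁻ x, min (f x) n ∂ν
        = ∫⁻ t in Ioi (0:ℝ), ν {x | t < (min (f x) n).toReal} := by
      intro ν
      rw [← lintegral_eq_lintegral_meas_lt ν
        (Eventually.of_forall fun x => ENNReal.toReal_nonneg) (hm n).aemeasurable]
      simp_rw [ENNReal.ofReal_toReal (hmin n _)]
    have hopen : ∀ t ∈ Ioi (0:ℝ), IsOpen {x | t < (min (f x) n).toReal} := by
      intro t ht
      have : {x | t < (min (f x) n).toReal}
          = f ⁻¹' (Ioi (ENNReal.ofReal t)) ∩ {_x | ENNReal.ofReal t < (n : ℝ≥0∞)} := by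
        ext x
        simp only [mem_ofPred_eq, mem_inter_iff, mem_preimage, mem_Ioi]
        rw [← ENNReal.ofReal_lt_iff_lt_toReal (le_of_lt ht) (hmin n x), lt_min_iff]
      rw [this]
      exact (lowerSemicontinuous_iff_isOpen_preimage.1 hf _).inter isOpen_const
    calc ∫⁻ x, min (f x) n ∂μ
        = ∫⁻ t in Ioi (0:ℝ), μ {x | t < (min (f x) n).toReal} := hrep μ
      _ ≤ ∫⁻ t in Ioi (0:ℝ), atTop.liminf (fun i => μs i {x | t < (min (f x) n).toReal}) :=
          setLIntegral_mono' measurableSet_Ioi (fun t ht => h_opens _ (hopen t ht))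
      _ ≤ atTop.liminf (fun i => ∫⁻ t in Ioi (0:ℝ), μs i {x | t < (min (f x) n).toReal}) :=
          lintegral_liminf_le (fun i => Antitone.measurable (fun s t hst =>
            measure_mono (fun x hx => lt_of_le_of_lt hst hx)))
      _ ≤ _ := by
          refine liminf_le_liminf (Eventually.of_forall fun i => ?_)
          rw [← hrep (μs i)]
          exact lintegral_mono (fun x => min_le_left _ _)
  have hsup : ∫⁻ x, f x ∂μ = ⨆ n : ℕ, ∫⁻ x, min (f x) n ∂μ := by
    rw [← lintegral_iSup (fun n => hfm.min measurable_const)]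
    · congr 1
      ext x
      rw [← inf_iSup_eq, ENNReal.iSup_natCast, inf_top_eq]
    · intro m n hmn x
      exact min_le_min_left _ (by exact_mod_cast hmn)
  rw [hsup]
  exact iSup_le key

theorem aux_compact {d : ℕ} {T : ℝ} (hT : 0 < T) (r C : ℝ) (hr : 1 < r) (hC : 0 < C)
    (L : Euc d → ℝ) (hLconv : ConvexOn ℝ Set.univ L) (hLcont : Continuous L)
    (hLgrow : ∀ p : Euc d, 1 / (r * C) * ‖p‖ ^ r - C ≤ L p ∧ L p ≤ C / r * ‖p‖ ^ r + C)
    (hLC : ∀ p, 0 ≤ L p + C) (Ω : Set (Euc d)) (hΩ : IsCompact Ω) (R : ℝ) (hR : 0 ≤ R) :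
    IsCompact {γ : Traj d T | evalAt hT.le 0 γ ∈ Ω ∧ actionN L C γ ≤ ENNReal.ofReal R} := by
  set K := {γ : Traj d T | evalAt hT.le 0 γ ∈ Ω ∧ actionN L C γ ≤ ENNReal.ofReal R} with hK
  have hclosed : IsClosed K := by
    refine IsClosed.inter (hΩ.isClosed.preimage (aux_continuous_evalAt hT.le 0)) ?_
    exact lowerSemicontinuous_iff_isClosed_preimage.1
      (aux_action_lsc hT r C hr hC L hLconv hLcont hLgrow hLC) _
  have hmod : ∀ γ ∈ K, ∀ l > 0, ∀ s t : Icc (0:ℝ) T,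
      dist (γ s) (γ t) ≤ l * dist s t + l ^ (1 - r) * (r * C) * R := by
    intro γ hγ l hl
    have main : ∀ s t : Icc (0:ℝ) T, s ≤ t →
        dist (γ s) (γ t) ≤ l * dist s t + l ^ (1 - r) * (r * C) * R := by
      intro s t hst
      have hE : ((1, fun _ => ((s:ℝ), (t:ℝ))) : ℕ × (ℕ → ℝ × ℝ)) ∈ goodP T := by
        refine ⟨fun i _ => ⟨s.2.1, hst, t.2.2⟩, ?_⟩
        simp
      have := aux_sum_dist_le hT.le r C hr hC L hLgrow hLC l hl γ _ hE R hR
        ((aux_partE_le hT.le L C hLconv hLcont hLC _ hE γ).trans hγ.2)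
      simp only [Finset.range_one, Finset.sum_singleton, evalAt, projIcc_val] at this
      rw [dist_comm, dist_eq_norm, dist_comm, Subtype.dist_eq, Real.dist_eq,
        abs_of_nonneg (sub_nonneg.2 (Subtype.coe_le_coe.2 hst))]
      exact this
    intro s t
    rcases le_total s t with h | h
    · exact main s t h
    · rw [dist_comm, dist_comm s t]; exact main t s h
  have hequi : Equicontinuous (fun (γ : K) => ((γ : Traj d T) : Icc (0:ℝ) T → Euc d)) := by
    intro s
    rw [Metric.equicontinuousAt_iff]
    intro ε hε
    obtain ⟨l, hl, δ, hδ, hlt⟩ := aux_modulus r C R ε hr hε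
    refine ⟨δ, hδ, fun t ht γ => ?_⟩
    have h1 := hmod γ γ.2 l hl s t
    rw [dist_comm] at ht
    have h2 : l * dist s t ≤ l * δ := by gcongr
    linarith
  let A : ℝ := 1 * T + 1 ^ (1 - r) * (r * C) * R
  have hball : IsCompact (Metric.cthickening A Ω) := hΩ.cthickening
  have hin : ∀ γ ∈ K, ∀ t, γ t ∈ Metric.cthickening A Ω := by
    intro γ hγ t
    have h0 : γ ⟨0, le_rfl, hT.le⟩ ∈ Ω := by
      have := hγ.1
      simpa [evalAt, projIcc_of_mem hT.le (show (0:ℝ) ∈ Icc 0 T from ⟨le_rfl, hT.le⟩)] using this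
    refine Metric.mem_cthickening_of_dist_le _ _ _ _ h0 ?_
    refine (hmod γ hγ 1 one_pos t ⟨0, le_rfl, hT.le⟩).trans ?_
    have : dist t ⟨0, le_rfl, hT.le⟩ ≤ T := by
      rw [Subtype.dist_eq, Real.dist_eq, sub_zero, abs_of_nonneg t.2.1]
      exact t.2.2
    simp only [A]
    gcongr
  let e := ContinuousMap.isometryEquivBoundedOfCompact (Icc (0:ℝ) T) (Euc d)
  have hc : IsCompact (closure (e '' K)) := by
    refine BoundedContinuousFunction.arzela_ascoli _ hball _ ?_ ?_
    · rintro f t ⟨γ, hγ, rfl⟩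
      exact hin γ hγ t
    · intro s
      rw [Metric.equicontinuousAt_iff]
      intro ε hε
      obtain ⟨δ, hδ, h⟩ := Metric.equicontinuousAt_iff.1 (hequi s) ε hε
      refine ⟨δ, hδ, fun t ht f => ?_⟩
      obtain ⟨γ, hγ, hf⟩ := f.2
      have := h t ht ⟨γ, hγ⟩
      rw [← hf]
      exact this
  have hcl : IsClosed (e '' K) := e.toHomeomorph.isClosedMap _ hclosed
  rw [hcl.closure_eq] at hc
  exact (e.toHomeomorph.isCompact_image).1 hc

theorem aux_map_narrow {d : ℕ} {T : ℝ} (hT : 0 ≤ T) (Q : ℕ → Measure (Traj d T))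
    (Q' : Measure (Traj d T)) (h : NarrowTendsto Q Q') (t : ℝ) :
    NarrowTendsto (fun n => (Q n).map (evalAt hT t)) (Q'.map (evalAt hT t)) := by
  intro f
  have hc := aux_continuous_evalAt (d := d) hT t
  have e : ∀ ν : Measure (Traj d T), ∫ x, f x ∂(ν.map (evalAt hT t))
      = ∫ γ, (f.compContinuous ⟨_, hc⟩) γ ∂ν := by
    intro ν
    rw [integral_map hc.measurable.aemeasurable f.continuous.aestronglyMeasurable]
    rfl
  simp_rw [e]
  exact h _

theorem aux_F_lsc {d : ℕ} {T : ℝ} (hT : 0 ≤ T) (F : Measure (Euc d) → ℝ≥0∞)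
    (hFlsc : ∀ (ρ : ℕ → Measure (Euc d)) (σ : Measure (Euc d)),
      (∀ n, IsFiniteMeasure (ρ n)) → IsFiniteMeasure σ → NarrowTendsto ρ σ →
      F σ ≤ liminf (fun n => F (ρ n)) atTop)
    (Q : Measure (Traj d T)) [IsProbabilityMeasure Q] :
    LowerSemicontinuous (fun t => F (Q.map (evalAt hT t))) := by
  rw [lowerSemicontinuous_iff_isClosed_preimage]
  intro y
  refine IsSeqClosed.isClosed ?_
  intro u t hu hut
  have hn : NarrowTendsto (fun n => Q.map (evalAt hT (u n))) (Q.map (evalAt hT t)) := by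
    intro f
    have e : ∀ s, ∫ x, f x ∂(Q.map (evalAt hT s)) = ∫ γ, f (evalAt hT s γ) ∂Q := fun s =>
      integral_map (aux_continuous_evalAt hT s).measurable.aemeasurable
        f.continuous.aestronglyMeasurable
    simp_rw [e]
    refine tendsto_integral_of_dominated_convergence (fun _ => ‖f‖) (fun n => ?_)
      (integrable_const _) (fun n => Eventually.of_forall fun γ => f.norm_coe_le_norm _)
      (Eventually.of_forall fun γ => ?_)
    · exact (f.continuous.comp (aux_continuous_evalAt hT (u n))).aestronglyMeasurable
    · exact ((f.continuous.comp (aux_continuous_evalAt_time hT γ)).tendsto t).comp hut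
  refine (hFlsc _ _ (fun n => inferInstance) inferInstance hn).trans ?_
  exact liminf_le_of_frequently_le' (Frequently.of_forall fun n => hu n)

theorem aux_coe_liminf (a : ℝ≥0∞) (u : ℕ → ℝ≥0∞) (h : a ≤ liminf u atTop) :
    (a : EReal) ≤ liminf (fun n => (u n : EReal)) atTop := by
  have hm : Monotone (fun x : ℝ≥0∞ => (x : EReal)) := fun x y hxy =>
    EReal.coe_ennreal_le_coe_ennreal_iff.2 hxy
  have := hm.map_liminf_of_continuousAt (F := atTop) u
    continuous_coe_ennreal_ereal.continuousAt
  refine (hm h).trans this.le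

theorem aux_J_lsc {d : ℕ} {T : ℝ} (hT : 0 < T) (r C : ℝ) (hr : 1 < r) (hC : 0 < C)
    (L : Euc d → ℝ) (hLconv : ConvexOn ℝ Set.univ L) (hLcont : Continuous L)
    (hLgrow : ∀ p : Euc d, 1 / (r * C) * ‖p‖ ^ r - C ≤ L p ∧ L p ≤ C / r * ‖p‖ ^ r + C)
    (hLC : ∀ p, 0 ≤ L p + C)
    (F : Measure (Euc d) → ℝ≥0∞)
    (hFlsc : ∀ (ρ : ℕ → Measure (Euc d)) (σ : Measure (Euc d)),
      (∀ n, IsFiniteMeasure (ρ n)) → IsFiniteMeasure σ → NarrowTendsto ρ σ →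
      F σ ≤ liminf (fun n => F (ρ n)) atTop)
    (G : Measure (Traj d T) → ℝ)
    (hGcont : ∀ (Q : ℕ → Measure (Traj d T)) (Q' : Measure (Traj d T)),
      (∀ n, IsProbabilityMeasure (Q n)) → IsProbabilityMeasure Q' →
      NarrowTendsto Q Q' → Tendsto (fun n => G (Q n)) atTop (𝓝 (G Q')))
    (Q : ℕ → Measure (Traj d T)) (Qlim : Measure (Traj d T))
    (hQ : ∀ n, IsProbabilityMeasure (Q n)) (hQl : IsProbabilityMeasure Qlim)
    (hn : NarrowTendsto Q Qlim) :
    Jfun hT.le L C F G Qlim ≤ liminf (fun n => Jfun hT.le L C F G (Q n)) atTop := by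
  let P : ℕ → ProbabilityMeasure (Traj d T) := fun n => ⟨Q n, hQ n⟩
  let Pl : ProbabilityMeasure (Traj d T) := ⟨Qlim, hQl⟩
  have hconv : Tendsto P atTop (𝓝 Pl) :=
    ProbabilityMeasure.tendsto_iff_forall_integral_tendsto.2 hn
  have hA : ∫⁻ γ, actionN L C γ ∂Qlim ≤ liminf (fun n => ∫⁻ γ, actionN L C γ ∂(Q n)) atTop :=
    aux_lintegral_lsc _ (aux_action_lsc hT r C hr hC L hLconv hLcont hLgrow hLC)
      (fun G hG => ProbabilityMeasure.le_liminf_measure_open_of_tendsto hconv hG)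
  have hB : ∫⁻ t in Ioc (0:ℝ) T, F (Qlim.map (evalAt hT.le t))
      ≤ liminf (fun n => ∫⁻ t in Ioc (0:ℝ) T, F ((Q n).map (evalAt hT.le t))) atTop := by
    calc _ ≤ ∫⁻ t in Ioc (0:ℝ) T, liminf (fun n => F ((Q n).map (evalAt hT.le t))) atTop := by
          refine lintegral_mono (fun t => ?_)
          exact hFlsc _ _ (fun n => inferInstance) inferInstance (aux_map_narrow hT.le Q Qlim hn t)
      _ ≤ _ := lintegral_liminf_le (fun n => (aux_F_lsc hT.le F hFlsc (Q n)).measurable)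
  have hG : ((G Qlim : ℝ) : EReal) ≤ liminf (fun n => ((G (Q n) : ℝ) : EReal)) atTop := by
    have := (continuous_coe_real_ereal.tendsto _).comp (hGcont Q Qlim hQ hQl hn)
    exact this.liminf_eq.ge
  have hk : kinE L C Qlim ≤ liminf (fun n => kinE L C (Q n)) atTop := by
    unfold kinE
    simp_rw [sub_eq_add_neg]
    have h1 := EReal.le_liminf_add (f := atTop)
      (u := fun n => ((∫⁻ γ, actionN L C γ ∂(Q n) : ℝ≥0∞) : EReal))
      (v := fun _ => -((C * T : ℝ) : EReal))
    refine le_trans (add_le_add (aux_coe_liminf _ _ hA) ?_) h1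
    simp
  unfold Jfun
  refine le_trans (add_le_add (le_trans (add_le_add hk (aux_coe_liminf _ _ hB)) EReal.le_liminf_add)
    hG) EReal.le_liminf_add

end LscAux

/-- The functional `J(Q) = ∫_Γ L dQ + ∫₀ᵀ F(e_t#Q) dt + G(Q)` is
lower semi-continuous on `P(Γ)` for the narrow topology, and the problem
`(M_{μ⁰}) : inf { J(Q) : Q ∈ P(Γ), e₀#Q = μ⁰ }` admits a minimizer. -/
theorem lsc_and_existence_of_minimizers
    (d : ℕ) (T : ℝ) (hT : 0 < T)
    (Ω : Set (Euc d)) (hΩc : IsCompact Ω) (hΩmeas : MeasurableSet Ω) (hΩne : Ω.Nonempty)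
    (r C : ℝ) (hr : 1 < r) (hC : 0 < C)
    (L : Euc d → ℝ) (hLconv : ConvexOn ℝ Set.univ L) (hLcont : Continuous L)
    (hLgrow : ∀ p : Euc d, 1 / (r * C) * ‖p‖ ^ r - C ≤ L p ∧ L p ≤ C / r * ‖p‖ ^ r + C)
    (F : Measure (Euc d) → ℝ≥0∞)
    (hFconv : ∀ ρ σ : Measure (Euc d), ∀ a b : ℝ≥0∞, a + b = 1 →
      F (a • ρ + b • σ) ≤ a * F ρ + b * F σ)
    (hFlsc : ∀ (ρ : ℕ → Measure (Euc d)) (σ : Measure (Euc d)),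
      (∀ n, IsFiniteMeasure (ρ n)) → IsFiniteMeasure σ → NarrowTendsto ρ σ →
      F σ ≤ liminf (fun n => F (ρ n)) atTop)
    (hFsupp : ∀ ρ : Measure (Euc d), F ρ ≠ ⊤ → ρ Ωᶜ = 0)
    (G : Measure (Traj d T) → ℝ)
    (hGconv : ∀ Q Q' : Measure (Traj d T), ∀ a : ℝ, a ∈ Set.Icc (0:ℝ) 1 →
      G (ENNReal.ofReal a • Q + ENNReal.ofReal (1 - a) • Q') ≤ a * G Q + (1 - a) * G Q')
    (hGcont : ∀ (Q : ℕ → Measure (Traj d T)) (Q' : Measure (Traj d T)),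
      (∀ n, IsProbabilityMeasure (Q n)) → IsProbabilityMeasure Q' →
      NarrowTendsto Q Q' → Tendsto (fun n => G (Q n)) atTop (𝓝 (G Q')))
    (hGbdd : BddBelow (Set.range G))
    (μ0 : Measure (Euc d)) (hμ0 : IsProbabilityMeasure μ0)
    (hμ0Ω : μ0 Ωᶜ = 0) (hμ0ac : μ0 ≪ volume) :
    (∀ (Q : ℕ → Measure (Traj d T)) (Qlim : Measure (Traj d T)),
        (∀ n, IsProbabilityMeasure (Q n)) → IsProbabilityMeasure Qlim →
        NarrowTendsto Q Qlim →
        Jfun hT.le L C F G Qlim ≤ liminf (fun n => Jfun hT.le L C F G (Q n)) atTop)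
    ∧ ∃ Qm : Measure (Traj d T), IsProbabilityMeasure Qm ∧
        Qm.map (evalAt hT.le 0) = μ0 ∧
        ∀ Q : Measure (Traj d T), IsProbabilityMeasure Q → Q.map (evalAt hT.le 0) = μ0 →
          Jfun hT.le L C F G Qm ≤ Jfun hT.le L C F G Q := by
  have hLC : ∀ p, 0 ≤ L p + C := fun p => by
    have h1 := (hLgrow p).1
    have h2 : 0 ≤ 1 / (r * C) * ‖p‖ ^ r := by positivity
    linarith
  have hlsc := aux_J_lsc hT r C hr hC L hLconv hLcont hLgrow hLC F hFlsc G hGcont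
  refine ⟨hlsc, ?_⟩
  have hem : ∀ t, Measurable (evalAt (d := d) hT.le t) := fun t =>
    (aux_continuous_evalAt hT.le t).measurable
  let S : Set EReal := {x | ∃ Q : Measure (Traj d T), IsProbabilityMeasure Q ∧
    Q.map (evalAt hT.le 0) = μ0 ∧ Jfun hT.le L C F G Q = x}
  -- a competitor: constant trajectories
  have hcc : Continuous (fun x : Euc d => (ContinuousMap.const (Icc (0:ℝ) T) x : Traj d T)) :=
    ContinuousMap.continuous_const'
  let Q0 : Measure (Traj d T) := μ0.map (fun x => ContinuousMap.const (Icc (0:ℝ) T) x)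
  have hQ0 : IsProbabilityMeasure Q0 :=
    Measure.isProbabilityMeasure_map hcc.measurable.aemeasurable
  have hQ0e : Q0.map (evalAt hT.le 0) = μ0 := by
    rw [Measure.map_map (hem 0) hcc.measurable]
    have : (evalAt hT.le 0 ∘ fun x => (ContinuousMap.const (Icc (0:ℝ) T) x : Traj d T)) = id := by
      ext x; simp [evalAt]
    rw [this, Measure.map_id]
  have hSne : S.Nonempty := ⟨_, Q0, hQ0, hQ0e, rfl⟩
  obtain ⟨u, -, hu, huS⟩ := exists_seq_tendsto_sInf hSne (OrderBot.bddBelow S)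
  by_cases htop : sInf S = ⊤
  · refine ⟨Q0, hQ0, hQ0e, fun Q hQ hQe => ?_⟩
    have : sInf S ≤ Jfun hT.le L C F G Q := sInf_le ⟨Q, hQ, hQe, rfl⟩
    rw [htop] at this
    exact le_top.trans this
  obtain ⟨M, hM1, -⟩ := EReal.lt_iff_exists_real_btwn.1 (lt_top_iff_ne_top.2 htop)
  obtain ⟨N, hN⟩ := (hu.eventually (gt_mem_nhds hM1)).exists_forall_of_atTop
  choose Q hQp hQe hQJ using fun n => huS (n + N)
  have hJlim : Tendsto (fun n => Jfun hT.le L C F G (Q n)) atTop (𝓝 (sInf S)) := by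
    simp_rw [hQJ]
    exact hu.comp (tendsto_add_atTop_nat N)
  obtain ⟨g0, hg0⟩ := hGbdd
  -- uniform bound on the kinetic part
  obtain ⟨B, hB0, hB⟩ : ∃ B : ℝ, 0 ≤ B ∧
      ∀ n, ∫⁻ γ, actionN L C γ ∂(Q n) ≤ ENNReal.ofReal B := by
    refine ⟨max (M + C * T - g0) 0, le_max_right _ _, fun n => ?_⟩
    have h1 : Jfun hT.le L C F G (Q n) < M := by
      rw [hQJ]; exact hN _ (Nat.le_add_left N n)
    have hG0 : g0 ≤ G (Q n) := hg0 ⟨Q n, rfl⟩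
    have h2 : ((∫⁻ γ, actionN L C γ ∂(Q n) : ℝ≥0∞) : EReal) - ((C * T : ℝ) : EReal)
        + 0 + ((g0 : ℝ) : EReal) ≤ Jfun hT.le L C F G (Q n) := by
      unfold Jfun kinE
      refine add_le_add (add_le_add le_rfl (EReal.coe_ennreal_nonneg _)) ?_
      exact_mod_cast hG0
    have h3 := h2.trans_lt h1
    generalize ∫⁻ γ, actionN L C γ ∂(Q n) = A at h3
    induction A with
    | top =>
      exfalso
      rw [EReal.coe_ennreal_top, EReal.top_sub_coe, add_zero, EReal.top_add_coe] at h3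
      exact not_top_lt h3
    | coe a =>
      have h5 : (((a : ℝ≥0∞)) : EReal) = ((a : ℝ) : EReal) := rfl
      rw [h5, ← EReal.coe_sub, add_zero, ← EReal.coe_add, EReal.coe_lt_coe_iff] at h3
      rw [← ENNReal.ofReal_coe_nnreal]
      exact ENNReal.ofReal_le_ofReal (le_trans (by linarith) (le_max_left _ _))
  have hlscA := aux_action_lsc hT r C hr hC L hLconv hLcont hLgrow hLC
  let P : ℕ → ProbabilityMeasure (Traj d T) := fun n => ⟨Q n, hQp n⟩
  have htight : IsTightMeasureSet
      {((μ : ProbabilityMeasure (Traj d T)) : Measure (Traj d T)) | μ ∈ Set.range P} := by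
    rw [isTightMeasureSet_iff_exists_isCompact_measure_compl_le]
    intro ε hε
    obtain ⟨δ, hδ0, hδ⟩ : ∃ δ : ℝ, 0 < δ ∧ ENNReal.ofReal δ ≤ ε := by
      obtain ⟨δ, h1, h2⟩ := ENNReal.lt_iff_exists_nnreal_btwn.1 hε
      exact ⟨δ, by exact_mod_cast h1, by simpa using h2.le⟩
    let R : ℝ := (B + 1) / δ
    have hR : 0 < R := by positivity
    refine ⟨_, aux_compact hT r C hr hC L hLconv hLcont hLgrow hLC Ω hΩc R hR.le, ?_⟩
    rintro _ ⟨_, ⟨n, rfl⟩, rfl⟩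
    show Q n _ ≤ ε
    have hsub : {γ : Traj d T | evalAt hT.le 0 γ ∈ Ω ∧ actionN L C γ ≤ ENNReal.ofReal R}ᶜ
        ⊆ (evalAt hT.le 0) ⁻¹' Ωᶜ ∪ {γ | ENNReal.ofReal R ≤ actionN L C γ} := by
      intro γ hγ
      by_cases h : evalAt hT.le 0 γ ∈ Ω
      · right
        by_contra h'
        exact hγ ⟨h, (not_le.1 h').le⟩
      · left; exact h
    refine (measure_mono hsub).trans ((measure_union_le _ _).trans ?_)
    have h1 : Q n ((evalAt hT.le 0) ⁻¹' Ωᶜ) = 0 := by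
      rw [← Measure.map_apply (hem 0) hΩmeas.compl, hQe, hμ0Ω]
    rw [h1, zero_add]
    have h2 := (mul_meas_ge_le_lintegral hlscA.measurable (μ := Q n) (ENNReal.ofReal R)).trans (hB n)
    have h3 : ENNReal.ofReal B ≤ ENNReal.ofReal R * ENNReal.ofReal δ := by
      rw [← ENNReal.ofReal_mul hR.le]
      apply ENNReal.ofReal_le_ofReal
      simp only [R]
      rw [div_mul_cancel₀ _ hδ0.ne']
      linarith
    have h4 := h2.trans h3
    rw [ENNReal.mul_le_mul_iff_right (ENNReal.ofReal_pos.2 hR).ne' ENNReal.ofReal_ne_top] at h4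
    exact h4.trans hδ
  have hcomp := isCompact_closure_of_isTightMeasureSet htight
  obtain ⟨Pm, -, ψ, hψ, hψlim⟩ := hcomp.tendsto_subseq
    (fun n => subset_closure (Set.mem_range_self (f := P) n))
  have hnar : NarrowTendsto (fun n => Q (ψ n)) (Pm : Measure (Traj d T)) :=
    ProbabilityMeasure.tendsto_iff_forall_integral_tendsto.1 hψlim
  refine ⟨Pm, inferInstance, ?_, fun Q' hQ' hQe' => ?_⟩
  · have hpm : IsProbabilityMeasure ((Pm : Measure (Traj d T)).map (evalAt hT.le 0)) :=
      Measure.isProbabilityMeasure_map (hem 0).aemeasurable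
    refine ext_of_forall_integral_eq_of_IsFiniteMeasure (fun f => ?_)
    have h1 := aux_map_narrow hT.le _ _ hnar 0 f
    simp_rw [hQe] at h1
    exact tendsto_nhds_unique h1 tendsto_const_nhds
  · have h1 := hlsc _ _ (fun n => hQp (ψ n)) inferInstance hnar
    have h2 := (hJlim.comp hψ.tendsto_atTop).liminf_eq
    refine h1.trans (le_trans (le_of_eq h2) ?_)
    exact sInf_le ⟨Q', hQ', hQe', rfl⟩
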